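/- Let Ω ⊂ ℂⁿ be a smooth bounded domain with smooth defining function ρ, let P ∈ bΩ, let h be a smooth real-valued function on a neighborhood of P, and let w ∈ T^{1,0}_P(bΩ). Write a_j = e^{−h}·(2/|∇ρ|²)·(∂ρ/∂z̄_j) for the coefficients of the field e^{−h}L_n. Then Σ_j (∂ρ/∂z_j)(P) · Σ_k w̄_k (∂a_j/∂z̄_k)(P) = −e^{−2h(P)} · L_{e^{h}ρ}(L_n(P), w̄)(P), where L_{e^{h}ρ} is the complex Hessian of the defining function e^{h}ρ. -/

import Mathlib

open Complex BigOperators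

noncomputable section

/-- The Wirtinger derivative `∂f/∂z_j` of `f : ℂⁿ → ℂ` at `z`:
`(1/2)(∂f/∂x_j − i ∂f/∂y_j)`, where the real directional derivatives are taken in the
directions `e_j` and `i·e_j` respectively. -/
def wDz (n : ℕ) (f : (Fin n → ℂ) → ℂ) (j : Fin n) (z : Fin n → ℂ) : ℂ :=
  (1 / 2 : ℂ) *
    (fderiv ℝ f z (Pi.single j 1) - Complex.I * fderiv ℝ f z (Pi.single j Complex.I))

/-- The Wirtinger derivative `∂f/∂z̄_j` of `f : ℂⁿ → ℂ` at `z`: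
`(1/2)(∂f/∂x_j + i ∂f/∂y_j)`. -/
def wDzbar (n : ℕ) (f : (Fin n → ℂ) → ℂ) (j : Fin n) (z : Fin n → ℂ) : ℂ :=
  (1 / 2 : ℂ) *
    (fderiv ℝ f z (Pi.single j 1) + Complex.I * fderiv ℝ f z (Pi.single j Complex.I))

/-- A real-valued function on `ℂⁿ` viewed as complex-valued. -/
def cplx (n : ℕ) (ρ : (Fin n → ℂ) → ℝ) : (Fin n → ℂ) → ℂ := fun z => (ρ z : ℂ)

/-- The complex Hessian (Levi form) `L_ρ(ζ, w̄)(P) = Σ_{j,k} ∂²ρ/∂z_j∂z̄_k (P) ζ_j w̄_k`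
of a real-valued function `ρ`. -/
def levi (n : ℕ) (ρ : (Fin n → ℂ) → ℝ) (P : Fin n → ℂ) (ζ w : Fin n → ℂ) : ℂ :=
  ∑ j, ∑ k,
    wDzbar n (fun z => wDz n (cplx n ρ) j z) k P * ζ j * (starRingEnd ℂ) (w k)

/-- The squared Euclidean norm of the real gradient of a real-valued function `ρ` on `ℂⁿ`:
`|∇ρ|² = 4 Σ_j |∂ρ/∂z_j|²`. -/
def gradSq (n : ℕ) (ρ : (Fin n → ℂ) → ℝ) (z : Fin n → ℂ) : ℝ :=
  4 * ∑ j, Complex.normSq (wDz n (cplx n ρ) j z)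

/-- The squared Euclidean norm `|w|²` of a vector `w ∈ ℂⁿ`. -/
def vnormSq (n : ℕ) (w : Fin n → ℂ) : ℝ := ∑ j, Complex.normSq (w j)

/-- The complex tangent space `T^{1,0}_P(bΩ) = {ζ : Σ_j ζ_j ∂ρ/∂z_j (P) = 0}`. -/
def cTangent (n : ℕ) (ρ : (Fin n → ℂ) → ℝ) (P : Fin n → ℂ) : Set (Fin n → ℂ) :=
  {ζ | ∑ j, ζ j * wDz n (cplx n ρ) j P = 0}

/-- The null space `N(P)` of the Levi form at `P`. -/
def leviNull (n : ℕ) (ρ : (Fin n → ℂ) → ℝ) (P : Fin n → ℂ) : Set (Fin n → ℂ) :=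
  {ζ | ζ ∈ cTangent n ρ P ∧ levi n ρ P ζ ζ = 0}

/-- The complex normal `L_n(P)`, the vector with `j`-th coefficient
`(2/|∇ρ|²) ∂ρ/∂z̄_j (P)`. -/
def cNormal (n : ℕ) (ρ : (Fin n → ℂ) → ℝ) (P : Fin n → ℂ) : Fin n → ℂ :=
  fun j => ((2 / gradSq n ρ P : ℝ) : ℂ) * wDzbar n (cplx n ρ) j P

/-- The complex linear span of `N(P)` and `L_n(P)`. -/
def nullNormalSpan (n : ℕ) (ρ : (Fin n → ℂ) → ℝ) (P : Fin n → ℂ) :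
    Submodule ℂ (Fin n → ℂ) :=
  Submodule.span ℂ (leviNull n ρ P ∪ {cNormal n ρ P})

/-- `ρ` is a smooth defining function for the domain `Ω`: it is smooth, `Ω = {ρ < 0}` and
`bΩ = {ρ = 0}` within a neighborhood `U` of the closure of `Ω`, and `∇ρ ≠ 0` on `bΩ`. -/
def IsDefining (n : ℕ) (Ω : Set (Fin n → ℂ)) (ρ : (Fin n → ℂ) → ℝ) : Prop :=
  ContDiff ℝ (⊤ : ℕ∞) ρ ∧
  ∃ U : Set (Fin n → ℂ), IsOpen U ∧ closure Ω ⊆ U ∧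
    Ω = {z | z ∈ U ∧ ρ z < 0} ∧
    frontier Ω = {z | z ∈ U ∧ ρ z = 0} ∧
    ∀ z ∈ frontier Ω, fderiv ℝ ρ z ≠ 0

/-- `Ω` (with defining function `ρ`) is pseudoconvex: the Levi form of `ρ` is positive
semidefinite on the complex tangent space at every boundary point. -/
def Pseudoconvex (n : ℕ) (Ω : Set (Fin n → ℂ)) (ρ : (Fin n → ℂ) → ℝ) : Prop :=
  ∀ P ∈ frontier Ω, ∀ ζ ∈ cTangent n ρ P, 0 ≤ (levi n ρ P ζ ζ).re

section Wirtinger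

variable {n : ℕ} {f g : (Fin n → ℂ) → ℂ} {ρ : (Fin n → ℂ) → ℝ} {z : Fin n → ℂ}

lemma wDz_mul (hf : DifferentiableAt ℝ f z) (hg : DifferentiableAt ℝ g z) (j : Fin n) :
    wDz n (fun x => f x * g x) j z = f z * wDz n g j z + g z * wDz n f j z := by
  simp only [wDz, fderiv_fun_mul hf hg, add_apply,
    smul_apply, smul_eq_mul]
  ring

lemma wDzbar_mul (hf : DifferentiableAt ℝ f z) (hg : DifferentiableAt ℝ g z) (j : Fin n) :
    wDzbar n (fun x => f x * g x) j z = f z * wDzbar n g j z + g z * wDzbar n f j z := by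
  simp only [wDzbar, fderiv_fun_mul hf hg, add_apply,
    smul_apply, smul_eq_mul]
  ring

lemma wDzbar_add (hf : DifferentiableAt ℝ f z) (hg : DifferentiableAt ℝ g z) (j : Fin n) :
    wDzbar n (fun x => f x + g x) j z = wDzbar n f j z + wDzbar n g j z := by
  simp only [wDzbar, fderiv_fun_add hf hg, add_apply]
  ring

lemma wDzbar_sum {ι : Type*} (s : Finset ι) {F : ι → (Fin n → ℂ) → ℂ}
    (hF : ∀ i ∈ s, DifferentiableAt ℝ (F i) z) (j : Fin n) :
    wDzbar n (fun x => ∑ i ∈ s, F i x) j z = ∑ i ∈ s, wDzbar n (F i) j z := by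
  simp only [wDzbar, fderiv_fun_sum hF, sum_apply, Finset.mul_sum,
    ← Finset.sum_add_distrib]

lemma wDzbar_const (c : ℂ) (j : Fin n) : wDzbar n (fun _ => c) j z = 0 := by
  simp [wDzbar]

lemma wDzbar_congr (hfg : f =ᶠ[nhds z] g) (j : Fin n) : wDzbar n f j z = wDzbar n g j z := by
  simp only [wDzbar, hfg.fderiv_eq]

/-- The derivative `Σ_k w̄_k ∂f/∂z̄_k` along the conjugate of the vector `w`. -/
def conjDeriv (n : ℕ) (w : Fin n → ℂ) (f : (Fin n → ℂ) → ℂ) (z : Fin n → ℂ) : ℂ :=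
  ∑ k, (starRingEnd ℂ) (w k) * wDzbar n f k z

lemma conjDeriv_mul (w : Fin n → ℂ) (hf : DifferentiableAt ℝ f z)
    (hg : DifferentiableAt ℝ g z) :
    conjDeriv n w (fun x => f x * g x) z
      = f z * conjDeriv n w g z + g z * conjDeriv n w f z := by
  simp only [conjDeriv, wDzbar_mul hf hg, Finset.mul_sum, ← Finset.sum_add_distrib]
  exact Finset.sum_congr rfl fun k _ => by ring

lemma conjDeriv_add (w : Fin n → ℂ) (hf : DifferentiableAt ℝ f z)
    (hg : DifferentiableAt ℝ g z) :
    conjDeriv n w (fun x => f x + g x) z = conjDeriv n w f z + conjDeriv n w g z := by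
  simp only [conjDeriv, wDzbar_add hf hg, mul_add, Finset.sum_add_distrib]

lemma conjDeriv_sum (w : Fin n → ℂ) {ι : Type*} (s : Finset ι) {F : ι → (Fin n → ℂ) → ℂ}
    (hF : ∀ i ∈ s, DifferentiableAt ℝ (F i) z) :
    conjDeriv n w (fun x => ∑ i ∈ s, F i x) z = ∑ i ∈ s, conjDeriv n w (F i) z := by
  simp only [conjDeriv, wDzbar_sum s hF, Finset.mul_sum]
  exact Finset.sum_comm

lemma conjDeriv_const (w : Fin n → ℂ) (c : ℂ) : conjDeriv n w (fun _ => c) z = 0 := by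
  simp [conjDeriv, wDzbar_const]

lemma conjDeriv_congr (w : Fin n → ℂ) (hfg : f =ᶠ[nhds z] g) :
    conjDeriv n w f z = conjDeriv n w g z := by
  simp only [conjDeriv, wDzbar_congr hfg]

lemma contDiffAt_cplx {m : WithTop ℕ∞} (hρ : ContDiffAt ℝ m ρ z) :
    ContDiffAt ℝ m (cplx n ρ) z :=
  Complex.ofRealCLM.contDiff.contDiffAt.comp z hρ

lemma differentiableAt_wDz (hf : ContDiffAt ℝ 2 f z) (j : Fin n) :
    DifferentiableAt ℝ (wDz n f j) z := by
  have hd : DifferentiableAt ℝ (fderiv ℝ f) z :=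
    (hf.fderiv_right (m := 1) (by norm_num)).differentiableAt (by norm_num)
  unfold wDz
  fun_prop

lemma differentiableAt_wDzbar (hf : ContDiffAt ℝ 2 f z) (j : Fin n) :
    DifferentiableAt ℝ (wDzbar n f j) z := by
  have hd : DifferentiableAt ℝ (fderiv ℝ f) z :=
    (hf.fderiv_right (m := 1) (by norm_num)).differentiableAt (by norm_num)
  unfold wDzbar
  fun_prop

lemma fderiv_cplx (hρ : DifferentiableAt ℝ ρ z) (v : Fin n → ℂ) :
    fderiv ℝ (cplx n ρ) z v = (fderiv ℝ ρ z v : ℂ) := by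
  have := (Complex.ofRealCLM.hasFDerivAt.comp z hρ.hasFDerivAt).fderiv
  change fderiv ℝ (Complex.ofRealCLM ∘ ρ) z v = _
  rw [this]
  simp

lemma conj_wDz_cplx (hρ : DifferentiableAt ℝ ρ z) (j : Fin n) :
    (starRingEnd ℂ) (wDz n (cplx n ρ) j z) = wDzbar n (cplx n ρ) j z := by
  simp [wDz, wDzbar, fderiv_cplx hρ, Complex.conj_ofNat]

lemma ofReal_gradSq (hρ : DifferentiableAt ℝ ρ z) :
    (gradSq n ρ z : ℂ) = 4 * ∑ j, wDz n (cplx n ρ) j z * wDzbar n (cplx n ρ) j z := by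
  simp [gradSq, ← conj_wDz_cplx hρ, Complex.mul_conj]

lemma gradSq_ne_zero (hρ : DifferentiableAt ℝ ρ z) (h0 : fderiv ℝ ρ z ≠ 0) :
    gradSq n ρ z ≠ 0 := by
  contrapose! h0
  have hr : ∀ j, wDz n (cplx n ρ) j z = 0 := by
    intro j
    have hs : ∑ j, Complex.normSq (wDz n (cplx n ρ) j z) = 0 := by
      simpa [gradSq] using h0
    rw [Finset.sum_eq_zero_iff_of_nonneg fun _ _ => Complex.normSq_nonneg _] at hs
    exact Complex.normSq_eq_zero.1 (hs j (Finset.mem_univ j))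
  have hcoord : ∀ j, fderiv ℝ ρ z (Pi.single j 1) = 0 ∧
      fderiv ℝ ρ z (Pi.single j Complex.I) = 0 := by
    intro j
    have hj := hr j
    rw [wDz, fderiv_cplx hρ, fderiv_cplx hρ] at hj
    have hre := congrArg Complex.re hj
    have him := congrArg Complex.im hj
    simp at hre him
    exact ⟨hre, him⟩
  ext v
  have hv : v = ∑ j, ((v j).re • (Pi.single j (1 : ℂ) : Fin n → ℂ)
      + (v j).im • (Pi.single j Complex.I : Fin n → ℂ)) := by
    conv_lhs => rw [← Finset.univ_sum_single v]
    refine Finset.sum_congr rfl fun j _ => ?_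
    rw [← Pi.single_smul, ← Pi.single_smul, ← Pi.single_add]
    congr 1
    simp [Complex.re_add_im]
  rw [hv]
  simp [hcoord]

lemma levi_eq_sum_conjDeriv (ζ w : Fin n → ℂ) :
    levi n ρ z ζ w = ∑ j, ζ j * conjDeriv n w (wDz n (cplx n ρ) j) z := by
  simp only [levi, conjDeriv, Finset.mul_sum]
  exact Finset.sum_congr rfl fun j _ => Finset.sum_congr rfl fun k _ => by ring

lemma conjDeriv_cplx_eq_zero (hρ : DifferentiableAt ℝ ρ z) {w : Fin n → ℂ}
    (hw : w ∈ cTangent n ρ z) : conjDeriv n w (cplx n ρ) z = 0 := by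
  simpa [conjDeriv, conj_wDz_cplx hρ] using congrArg (starRingEnd ℂ) hw

/-- At a zero of `ρ`, the Hessian of `E * ρ` against a vector `w` tangential for `ρ` only
involves first derivatives of `E`. -/
lemma levi_mul_of_cTangent {E : (Fin n → ℂ) → ℝ} (hE : ContDiffAt ℝ 2 E z)
    (hρ : ContDiffAt ℝ 2 ρ z) (hz : ρ z = 0) {w : Fin n → ℂ} (hw : w ∈ cTangent n ρ z)
    (ζ : Fin n → ℂ) :
    levi n (fun x => E x * ρ x) z ζ w
      = cplx n E z * levi n ρ z ζ w
        + conjDeriv n w (cplx n E) z * ∑ j, wDz n (cplx n ρ) j z * ζ j := by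
  have hEc := contDiffAt_cplx hE
  have hρc := contDiffAt_cplx hρ
  have hEd := hEc.differentiableAt (by norm_num)
  have hρd := hρc.differentiableAt (by norm_num)
  have key : ∀ j, conjDeriv n w (wDz n (cplx n fun x => E x * ρ x) j) z
      = cplx n E z * conjDeriv n w (wDz n (cplx n ρ) j) z
        + conjDeriv n w (cplx n E) z * wDz n (cplx n ρ) j z := by
    intro j
    have hEj := differentiableAt_wDz hEc j
    have hρj := differentiableAt_wDz hρc j
    have hev : wDz n (cplx n fun x => E x * ρ x) j =ᶠ[nhds z] fun x =>
        cplx n E x * wDz n (cplx n ρ) j x + cplx n ρ x * wDz n (cplx n E) j x := by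
      filter_upwards [hEc.eventually (by norm_num), hρc.eventually (by norm_num)] with x h1 h2
      rw [← wDz_mul (h1.differentiableAt (by norm_num)) (h2.differentiableAt (by norm_num))]
      congr 1
      ext y
      simp [cplx]
    have hz' : cplx n ρ z = 0 := by simp [cplx, hz]
    rw [conjDeriv_congr w hev, conjDeriv_add w (hEd.fun_mul hρj) (hρd.fun_mul hEj),
      conjDeriv_mul w hEd hρj, conjDeriv_mul w hρd hEj,
      conjDeriv_cplx_eq_zero (hρ.differentiableAt (by norm_num)) hw, hz']
    ring
  simp only [levi_eq_sum_conjDeriv, key, Finset.mul_sum, ← Finset.sum_add_distrib]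
  exact Finset.sum_congr rfl fun j _ => by ring

lemma sum_wDz_mul_cNormal (hρ : DifferentiableAt ℝ ρ z) (h0 : gradSq n ρ z ≠ 0) :
    ∑ j, wDz n (cplx n ρ) j z * cNormal n ρ z j = 1 / 2 := by
  have hg := ofReal_gradSq hρ
  have h0' : (gradSq n ρ z : ℂ) ≠ 0 := by exact_mod_cast h0
  have : ∑ j, wDz n (cplx n ρ) j z * cNormal n ρ z j
      = 2 / (gradSq n ρ z : ℂ) * ∑ j, wDz n (cplx n ρ) j z * wDzbar n (cplx n ρ) j z := by
    rw [Finset.mul_sum]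
    refine Finset.sum_congr rfl fun j _ => ?_
    simp only [cNormal]
    push_cast
    ring
  rw [this]
  field_simp
  linear_combination -hg

lemma differentiableAt_gradSq (hρ : ContDiffAt ℝ 2 ρ z) :
    DifferentiableAt ℝ (gradSq n ρ) z := by
  have hd : ∀ j, DifferentiableAt ℝ (wDz n (cplx n ρ) j) z :=
    differentiableAt_wDz (contDiffAt_cplx hρ)
  have hre : ∀ j, DifferentiableAt ℝ (fun x => (wDz n (cplx n ρ) j x).re) z :=
    fun j => Complex.reCLM.differentiableAt.comp z (hd j)
  have him : ∀ j, DifferentiableAt ℝ (fun x => (wDz n (cplx n ρ) j x).im) z :=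
    fun j => Complex.imCLM.differentiableAt.comp z (hd j)
  unfold gradSq
  simp only [Complex.normSq_apply]
  fun_prop

lemma differentiableAt_cNormal (hρ : ContDiffAt ℝ 2 ρ z) (h0 : gradSq n ρ z ≠ 0)
    (j : Fin n) : DifferentiableAt ℝ (fun x => cNormal n ρ x j) z := by
  have hg : DifferentiableAt ℝ (fun x => 2 / gradSq n ρ x) z :=
    by
    simp only [div_eq_mul_inv]
    exact (differentiableAt_const _).mul ((differentiableAt_gradSq hρ).inv h0)
  exact (Complex.ofRealCLM.differentiableAt.comp z hg).mul
    (differentiableAt_wDzbar (contDiffAt_cplx hρ) j)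

/-- Since `Σ_j (∂ρ/∂z_j) L_n^j = 1/2` near `z`, differentiating the coefficients of `G L_n`
amounts to differentiating `∂ρ/∂z_j`, up to the derivative of `G`. -/
lemma sum_wDz_mul_conjDeriv_cNormal (hρ : ContDiffAt ℝ 2 ρ z) (h0 : gradSq n ρ z ≠ 0)
    (w : Fin n → ℂ) (hf : DifferentiableAt ℝ f z) :
    ∑ j, wDz n (cplx n ρ) j z * conjDeriv n w (fun x => f x * cNormal n ρ x j) z
      = 1 / 2 * conjDeriv n w f z - f z * levi n ρ z (cNormal n ρ z) w := by
  have hL := differentiableAt_cNormal hρ h0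
  have hr : ∀ j, DifferentiableAt ℝ (wDz n (cplx n ρ) j) z :=
    differentiableAt_wDz (contDiffAt_cplx hρ)
  have hev : (fun x => ∑ j, wDz n (cplx n ρ) j x * cNormal n ρ x j)
      =ᶠ[nhds z] fun _ => 1 / 2 := by
    filter_upwards [hρ.eventually (by norm_num),
      (differentiableAt_gradSq hρ).continuousAt.eventually_ne h0] with x h1 h2
    exact sum_wDz_mul_cNormal (h1.differentiableAt (by norm_num)) h2
  have hzero : ∑ j, (wDz n (cplx n ρ) j z * conjDeriv n w (fun x => cNormal n ρ x j) z
      + cNormal n ρ z j * conjDeriv n w (wDz n (cplx n ρ) j) z) = 0 := by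
    rw [← conjDeriv_const w (1 / 2), ← conjDeriv_congr w hev,
      conjDeriv_sum w _ fun j _ => (hr j).fun_mul (hL j)]
    exact Finset.sum_congr rfl fun j _ => (conjDeriv_mul w (hr j) (hL j)).symm
  rw [Finset.sum_add_distrib, ← levi_eq_sum_conjDeriv] at hzero
  have hsplit : ∑ j, wDz n (cplx n ρ) j z * conjDeriv n w (fun x => f x * cNormal n ρ x j) z
      = f z * ∑ j, wDz n (cplx n ρ) j z * conjDeriv n w (fun x => cNormal n ρ x j) z
        + (∑ j, wDz n (cplx n ρ) j z * cNormal n ρ z j) * conjDeriv n w f z := by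
    rw [Finset.mul_sum, Finset.sum_mul, ← Finset.sum_add_distrib]
    refine Finset.sum_congr rfl fun j _ => ?_
    rw [conjDeriv_mul w hf (hL j)]
    ring
  rw [hsplit, sum_wDz_mul_cNormal (hρ.differentiableAt (by norm_num)) h0]
  linear_combination f z * hzero

end Wirtinger

/-- for a smooth bounded domain with defining function `ρ`, a boundary point
`P`, a smooth real function `h` near `P`, and `w ∈ T^{1,0}_P(bΩ)`, writing
`a_j = e^{−h}·(2/|∇ρ|²)·∂ρ/∂z̄_j` for the coefficients of `e^{−h}L_n`, one has
`Σ_j ∂ρ/∂z_j(P) · Σ_k w̄_k ∂a_j/∂z̄_k(P) = −e^{−2h(P)} · L_{e^{h}ρ}(L_n(P), w̄)(P)`. -/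
theorem normal_field_commutator_eq_hessian (n : ℕ) (Ω : Set (Fin n → ℂ))
    (hΩ : Bornology.IsBounded Ω) (ρ : (Fin n → ℂ) → ℝ) (hρ : IsDefining n Ω ρ)
    (P : Fin n → ℂ) (hP : P ∈ frontier Ω)
    (V : Set (Fin n → ℂ)) (hV : IsOpen V) (hPV : P ∈ V)
    (h : (Fin n → ℂ) → ℝ) (hh : ContDiffOn ℝ (⊤ : ℕ∞) h V)
    (w : Fin n → ℂ) (hw : w ∈ cTangent n ρ P) :
    ∑ j, wDz n (cplx n ρ) j P *
        (∑ k, (starRingEnd ℂ) (w k) *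
          wDzbar n
            (fun z => ((Real.exp (-h z) : ℝ) : ℂ) * ((2 / gradSq n ρ z : ℝ) : ℂ) *
              wDzbar n (cplx n ρ) j z) k P)
      = -(((Real.exp (-(2 * h P)) : ℝ) : ℂ)) *
          levi n (fun z => Real.exp (h z) * ρ z) P (cNormal n ρ P) w := by
  obtain ⟨hρs, U, -, -, -, hfr, hne⟩ := hρ
  have hρ2 : ContDiffAt ℝ 2 ρ P := hρs.contDiffAt.of_le (WithTop.coe_le_coe.2 (le_top : (2 : ℕ∞) ≤ ⊤))
  have hh2 : ContDiffAt ℝ 2 h P :=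
    (hh.contDiffAt (hV.mem_nhds hPV)).of_le (WithTop.coe_le_coe.2 (le_top : (2 : ℕ∞) ≤ ⊤))
  have hρP : ρ P = 0 := by
    rw [hfr] at hP
    exact hP.2
  have h0 := gradSq_ne_zero (hρ2.differentiableAt (by norm_num)) (hne P hP)
  have hG : DifferentiableAt ℝ (cplx n fun z => Real.exp (-h z)) P :=
    (contDiffAt_cplx hh2.neg.exp).differentiableAt (by norm_num)
  have hE : DifferentiableAt ℝ (cplx n fun z => Real.exp (h z)) P :=
    (contDiffAt_cplx hh2.exp).differentiableAt (by norm_num)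
  have hGE : ∀ z, cplx n (fun z => Real.exp (-h z)) z * cplx n (fun z => Real.exp (h z)) z
      = 1 := by
    intro z
    simp only [cplx]
    rw [← Complex.ofReal_mul, ← Real.exp_add]
    simp
  have hD := conjDeriv_mul w hG hE
  rw [funext hGE, conjDeriv_const] at hD
  have hsq : ((Real.exp (-(2 * h P)) : ℝ) : ℂ) = cplx n (fun z => Real.exp (-h z)) P ^ 2 := by
    simp only [cplx]
    rw [← Complex.ofReal_pow, ← Real.exp_nat_mul]
    congr 2
    push_cast
    ring
  have hL := sum_wDz_mul_conjDeriv_cNormal hρ2 h0 w hG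
  rw [levi_mul_of_cTangent hh2.exp hρ2 hρP hw, hsq,
    sum_wDz_mul_cNormal (hρ2.differentiableAt (by norm_num)) h0]
  simp only [mul_assoc]
  refine hL.trans ?_
  have hP1 := hGE P
  set G := cplx n (fun z => Real.exp (-h z)) P
  set E := cplx n (fun z => Real.exp (h z)) P
  linear_combination (G * levi n ρ P (cNormal n ρ P) w
    - 1 / 2 * conjDeriv n w (cplx n fun z => Real.exp (-h z)) P) * hP1 - 1 / 2 * G * hD
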